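/- Kazdan–Warner identity: Let g = e^{2f} g_{S²} be a metric on S² conformal to the round metric, with Gauss curvature K_g, and let x_i (i = 1,2,3) be the restriction to S² of the i-th Euclidean coordinate function. Then ∫_{S²} ⟨∇K_g, ∇x_i⟩_{g_{S²}} dvol_g = 0, where ∇ is the gradient with respect to the round metric. -/

import Mathlib

open MeasureTheory
open scoped RealInnerProductSpace

theorem hausdorffMeasure_sphere_lt_top :
    (μH[2] : Measure (EuclideanSpace ℝ (Fin 3))) (Metric.sphere 0 1) < ⊤ := by
  let φ : ℝ × ℝ → EuclideanSpace ℝ (Fin 3) := fun a =>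
    !₂[Real.sin a.1 * Real.cos a.2, Real.sin a.1 * Real.sin a.2, Real.cos a.1]
  let B : Set (ℝ × ℝ) := Set.Icc (-4) 4 ×ˢ Set.Icc (-4) 4
  have hB : IsCompact B := isCompact_Icc.prod isCompact_Icc
  have hφ : ContDiff ℝ 1 φ := by
    rw [contDiff_euclidean]
    intro i
    fin_cases i <;> simp [φ] <;> fun_prop
  obtain ⟨C, hC⟩ := hφ.contDiffOn.exists_lipschitzOnWith one_ne_zero
    ((convex_Icc _ _).prod (convex_Icc _ _)) hB
  have hsub : Metric.sphere (0 : EuclideanSpace ℝ (Fin 3)) 1 ⊆ φ '' B := by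
    intro x hx
    have hx1 : x 0 ^ 2 + x 1 ^ 2 + x 2 ^ 2 = 1 := by
      have := EuclideanSpace.real_norm_sq_eq x
      rw [mem_sphere_zero_iff_norm.1 hx, Fin.sum_univ_three] at this
      linarith
    let z : ℂ := ⟨x 0, x 1⟩
    have hz : Real.sqrt (1 - x 2 ^ 2) = ‖z‖ := by
      rw [Complex.norm_def, Complex.normSq_apply]
      congr 1
      simp only [z]
      linarith
    have hpi := Real.pi_lt_four
    refine ⟨(Real.arccos (x 2), z.arg), ⟨⟨?_, ?_⟩, ⟨?_, ?_⟩⟩, ?_⟩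
    · linarith [Real.arccos_nonneg (x 2)]
    · linarith [Real.arccos_le_pi (x 2)]
    · linarith [Complex.neg_pi_lt_arg z]
    · linarith [Complex.arg_le_pi z]
    · ext i
      fin_cases i
      · simp [φ, Real.sin_arccos, hz, Complex.norm_mul_cos_arg, z]
      · simp [φ, Real.sin_arccos, hz, Complex.norm_mul_sin_arg, z]
      · simpa [φ] using Real.cos_arccos (x := x 2) (by nlinarith) (by nlinarith)
  calc _ ≤ μH[2] (φ '' B) := measure_mono hsub
    _ ≤ (C : ENNReal) ^ (2 : ℝ) * μH[2] B := hC.hausdorffMeasure_image_le zero_le_two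
    _ < ⊤ := by
      rw [hausdorffMeasure_prod_real]
      exact ENNReal.mul_lt_top (by simp) hB.measure_lt_top

/-- The derivative of a function along an infinitesimal rotation integrates to zero over the sphere. -/
theorem integral_sphere_fderiv_skew {h : EuclideanSpace ℝ (Fin 3) → ℝ}
    (hh : ∀ x, x ≠ 0 → ContDiffAt ℝ 1 h x)
    {A : EuclideanSpace ℝ (Fin 3) →L[ℝ] EuclideanSpace ℝ (Fin 3)}
    (hA : A ∈ skewAdjoint (EuclideanSpace ℝ (Fin 3) →L[ℝ] EuclideanSpace ℝ (Fin 3))) :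
    Integrable (fun p => fderiv ℝ h p (A p)) (μH[2].restrict (Metric.sphere 0 1)) ∧
    ∫ p in Metric.sphere (0 : EuclideanSpace ℝ (Fin 3)) 1, fderiv ℝ h p (A p) ∂(μH[2]) = 0 := by
  set S := Metric.sphere (0 : EuclideanSpace ℝ (Fin 3)) 1 with hS
  have hSm : MeasurableSet S := Metric.isClosed_sphere.measurableSet
  have hScomp : IsCompact S := isCompact_sphere _ _
  have hS0 : ∀ x ∈ S, x ≠ 0 := fun x hx h0 => by simp [hS, h0] at hx
  have : IsFiniteMeasure ((μH[2] : Measure (EuclideanSpace ℝ (Fin 3))).restrict S) :=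
    ⟨by simpa using hausdorffMeasure_sphere_lt_top⟩
  let R : ℝ → EuclideanSpace ℝ (Fin 3) →L[ℝ] EuclideanSpace ℝ (Fin 3) :=
    fun t => NormedSpace.exp (t • A)
  have hR0 : R 0 = 1 := by
    have h0 : (0 : ℝ) • A = 0 := zero_smul ℝ A
    simp only [R, h0, NormedSpace.exp_zero]
  let _ : NormedAlgebra ℚ (EuclideanSpace ℝ (Fin 3) →L[ℝ] EuclideanSpace ℝ (Fin 3)) :=
    NormedAlgebra.restrictScalars ℚ ℝ _
  have hRu : ∀ t, R t ∈ unitary (EuclideanSpace ℝ (Fin 3) →L[ℝ] EuclideanSpace ℝ (Fin 3)) :=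
    fun t => NormedSpace.exp_mem_unitary_of_mem_skewAdjoint (skewAdjoint.smul_mem t hA)
  have hRS : ∀ t, ∀ x ∈ S, R t x ∈ S := fun t x hx => by
    rw [hS, mem_sphere_zero_iff_norm, ContinuousLinearMap.norm_map_of_mem_unitary (hRu t)]
    exact mem_sphere_zero_iff_norm.1 hx
  have hinv : ∀ t, ∫ p in S, h (R t p) ∂(μH[2]) = ∫ p in S, h p ∂(μH[2]) := fun t => by
    let e := Unitary.linearIsometryEquiv ⟨R t, hRu t⟩
    have he : ∀ x, e x = R t x := fun x => rfl
    have hpre : e ⁻¹' S = S := by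
      ext x
      simp [hS]
    have hmp := e.toIsometryEquiv.measurePreserving_hausdorffMeasure 2
    have := hmp.setIntegral_preimage_emb
      e.toIsometryEquiv.toHomeomorph.measurableEmbedding h S
    simpa [hpre, he] using this
  have hcont : ContinuousOn h S := fun x hx => (hh x (hS0 x hx)).continuousAt.continuousWithinAt
  have hcont' : ContinuousOn (fun p => fderiv ℝ h p (A p)) S := fun x hx =>
    (((hh x (hS0 x hx)).fderiv_right (m := 0) (by norm_num)).continuousAt.clm_apply
      A.continuous.continuousAt).continuousWithinAt
  obtain ⟨C, hC⟩ := hScomp.exists_bound_of_continuousOn hcont'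
  have hderivR : ∀ t p, HasDerivAt (fun t => R t p) (A (R t p)) t := fun t p => by
    have := (hasDerivAt_exp_smul_const' A t).clm_apply (hasDerivAt_const t p)
    simpa using this
  have key := hasDerivAt_integral_of_dominated_loc_of_deriv_le
    (μ := (μH[2] : Measure (EuclideanSpace ℝ (Fin 3))).restrict S)
    (F := fun t p => h (R t p)) (F' := fun t p => fderiv ℝ h (R t p) (A (R t p)))
    (x₀ := (0 : ℝ)) (s := Set.univ) (bound := fun _ => C) Filter.univ_mem
    (Filter.Eventually.of_forall fun t =>
      (hcont.comp (R t).continuous.continuousOn (hRS t)).aestronglyMeasurable hSm)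
    (by
      simpa only [hR0, one_apply_eq_self] using!
        hcont.integrableOn_of_subset_isCompact hScomp hSm subset_rfl hausdorffMeasure_sphere_lt_top.ne)
    ((hcont'.comp (R 0).continuous.continuousOn (hRS 0)).aestronglyMeasurable hSm)
    ((ae_restrict_mem hSm).mono fun p hp t _ => hC _ (hRS t p hp))
    (integrable_const C)
    ((ae_restrict_mem hSm).mono fun p hp t _ =>
      ((hh _ (hS0 _ (hRS t p hp))).differentiableAt one_ne_zero).hasFDerivAt.comp_hasDerivAt t
        (hderivR t p))
  simp only [hinv] at key
  have h0 := key.2.unique (hasDerivAt_const _ _)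
  exact ⟨by simpa [hR0] using key.1, by simpa [hR0] using h0⟩

theorem coord_skew_mem_skewAdjoint (j l : Fin 3) :
    (EuclideanSpace.proj l).smulRight (EuclideanSpace.single j (1 : ℝ)) -
      (EuclideanSpace.proj j).smulRight (EuclideanSpace.single l (1 : ℝ)) ∈
    skewAdjoint (EuclideanSpace ℝ (Fin 3) →L[ℝ] EuclideanSpace ℝ (Fin 3)) := by
  rw [skewAdjoint.mem_iff, ContinuousLinearMap.star_eq_adjoint, eq_comm,
    ContinuousLinearMap.eq_adjoint_iff]
  intro x y
  simp [inner_sub_left, inner_sub_right, inner_smul_left, inner_smul_right,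
    EuclideanSpace.inner_single_left, EuclideanSpace.inner_single_right]
  ring

theorem hasFDerivAt_coord (l : Fin 3) (p : EuclideanSpace ℝ (Fin 3)) :
    HasFDerivAt (fun y : EuclideanSpace ℝ (Fin 3) => y l)
      (EuclideanSpace.proj l : EuclideanSpace ℝ (Fin 3) →L[ℝ] ℝ) p :=
  (EuclideanSpace.proj l : EuclideanSpace ℝ (Fin 3) →L[ℝ] ℝ).hasFDerivAt

theorem sum_coord_mul_fderiv_of_sum_eq_zero {W : Fin 3 → EuclideanSpace ℝ (Fin 3) → ℝ}
    (hW : ∀ j x, x ≠ 0 → DifferentiableAt ℝ (W j) x)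
    (htan : ∀ x, x ≠ 0 → ∑ j, x j * W j x = 0)
    {p : EuclideanSpace ℝ (Fin 3)} (hp : p ≠ 0) (l : Fin 3) :
    ∑ j, p j * fderiv ℝ (W j) p (EuclideanSpace.single l 1) + W l p = 0 := by
  have h1 : HasFDerivAt (fun x : EuclideanSpace ℝ (Fin 3) => ∑ j, x j * W j x) _ p :=
    HasFDerivAt.fun_sum fun j _ => (hasFDerivAt_coord j p).mul (hW j p hp).hasFDerivAt
  have h2 : HasFDerivAt (fun x : EuclideanSpace ℝ (Fin 3) => ∑ j, x j * W j x)
      (0 : EuclideanSpace ℝ (Fin 3) →L[ℝ] ℝ) p :=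
    (hasFDerivAt_const 0 p).congr_of_eventuallyEq
      ((eventually_ne_nhds hp).mono fun x hx => htan x hx)
  have h3 := DFunLike.congr_fun (h1.unique h2) (EuclideanSpace.single l 1)
  simpa [Finset.sum_add_distrib, Pi.single_apply] using h3

/-- Divergence theorem on the unit sphere, for vector fields tangent to the concentric spheres. -/
theorem integral_sphere_divergence_eq_zero {W : Fin 3 → EuclideanSpace ℝ (Fin 3) → ℝ}
    (hW : ∀ j x, x ≠ 0 → ContDiffAt ℝ 1 (W j) x)
    (htan : ∀ x, x ≠ 0 → ∑ j, x j * W j x = 0) :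
    ∫ p in Metric.sphere (0 : EuclideanSpace ℝ (Fin 3)) 1,
      ∑ j, fderiv ℝ (W j) p (EuclideanSpace.single j 1) ∂(μH[2]) = 0 := by
  have hrot := fun j l => integral_sphere_fderiv_skew
    (h := fun y : EuclideanSpace ℝ (Fin 3) => y l * W j y)
    (fun x hx => (EuclideanSpace.proj l : EuclideanSpace ℝ (Fin 3) →L[ℝ] ℝ).contDiff.contDiffAt.mul
      (hW j x hx))
    (coord_skew_mem_skewAdjoint j l)
  have hsum := Finset.sum_eq_zero fun j (_ : j ∈ Finset.univ) =>
    Finset.sum_eq_zero fun l (_ : l ∈ Finset.univ) => (hrot j l).2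
  simp_rw [← integral_finsetSum _ fun l _ => (hrot _ l).1] at hsum
  rw [← integral_finsetSum _ fun j _ => integrable_finsetSum _ fun l _ => (hrot j l).1] at hsum
  rw [← hsum]
  refine setIntegral_congr_fun Metric.isClosed_sphere.measurableSet fun p hp => ?_
  have hp1 := mem_sphere_zero_iff_norm.1 hp
  have hp0 : p ≠ 0 := fun h0 => by simp [h0] at hp1
  have hr : p 0 ^ 2 + p 1 ^ 2 + p 2 ^ 2 = 1 := by
    have := EuclideanSpace.real_norm_sq_eq p
    rw [hp1, Fin.sum_univ_three] at this
    linarith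
  have hd := fun j => (hW j p hp0).differentiableAt one_ne_zero
  have hfd : ∀ j l, fderiv ℝ (fun y : EuclideanSpace ℝ (Fin 3) => y l * W j y) p = _ :=
    fun j l => ((hasFDerivAt_coord l p).mul (hd j).hasFDerivAt).fderiv
  have ht := htan p hp0
  have hdt := sum_coord_mul_fderiv_of_sum_eq_zero
    (fun j x hx => (hW j x hx).differentiableAt one_ne_zero) htan hp0
  have hdt0 := hdt 0
  have hdt1 := hdt 1
  have hdt2 := hdt 2
  simp only [Fin.sum_univ_three] at ht hdt0 hdt1 hdt2
  simp [hfd, Fin.sum_univ_three]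
  linear_combination -(fderiv ℝ (W 0) p (EuclideanSpace.single 0 1) +
    fderiv ℝ (W 1) p (EuclideanSpace.single 1 1) +
    fderiv ℝ (W 2) p (EuclideanSpace.single 2 1)) * hr + ht +
    p 0 * hdt0 + p 1 * hdt1 + p 2 * hdt2

theorem fderiv_apply_eq_sum_coord (g : EuclideanSpace ℝ (Fin 3) → ℝ)
    (p v : EuclideanSpace ℝ (Fin 3)) :
    fderiv ℝ g p v = ∑ j, v j * fderiv ℝ g p (EuclideanSpace.single j 1) := by
  conv_lhs => rw [← (EuclideanSpace.basisFun (Fin 3) ℝ).sum_repr v]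
  simp [map_sum]

theorem fderiv_apply_self_of_homogeneous {f : EuclideanSpace ℝ (Fin 3) → ℝ}
    (hf_hom : ∀ x, x ≠ 0 → f x = f (‖x‖⁻¹ • x)) {p : EuclideanSpace ℝ (Fin 3)} (hp : p ≠ 0)
    (hf : DifferentiableAt ℝ f p) : fderiv ℝ f p p = 0 := by
  have hline : HasDerivAt (fun t : ℝ => t • p) p 1 := by
    simpa using (hasDerivAt_id (1 : ℝ)).smul_const p
  have h1 : HasDerivAt (fun t : ℝ => f (t • p)) (fderiv ℝ f p p) 1 :=
    HasFDerivAt.comp_hasDerivAt (1 : ℝ) (by simpa using hf.hasFDerivAt) hline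
  have h2 : HasDerivAt (fun t : ℝ => f (t • p)) 0 1 := by
    refine (hasDerivAt_const 1 (f p)).congr_of_eventuallyEq ?_
    filter_upwards [lt_mem_nhds (zero_lt_one (α := ℝ))] with t ht
    rw [hf_hom _ (smul_ne_zero ht.ne' hp), hf_hom p hp, norm_smul, Real.norm_of_nonneg ht.le,
      smul_smul, mul_inv, mul_right_comm, inv_mul_cancel₀ ht.ne', one_mul]
  exact h1.unique h2

theorem fderiv_tangent_eq_of_eqOn_sphere {K G : EuclideanSpace ℝ (Fin 3) → ℝ}
    (hK_hom : ∀ x, x ≠ 0 → K x = K (‖x‖⁻¹ • x)) (hKG : ∀ x, ‖x‖ = 1 → K x = G x)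
    {p v : EuclideanSpace ℝ (Fin 3)} (hp : ‖p‖ = 1) (hv : ⟪p, v⟫ = 0)
    (hK : DifferentiableAt ℝ K p) (hG : DifferentiableAt ℝ G p) :
    fderiv ℝ K p v = fderiv ℝ G p v := by
  have hline : HasDerivAt (fun t : ℝ => p + t • v) v 0 := by
    simpa using ((hasDerivAt_id (0 : ℝ)).smul_const v).const_add p
  have h1 : HasDerivAt (fun t : ℝ => K (p + t • v)) (fderiv ℝ K p v) 0 :=
    HasFDerivAt.comp_hasDerivAt (0 : ℝ) (by simpa using hK.hasFDerivAt) hline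
  have hp0 : p ≠ 0 := fun h0 => by simp [h0] at hp
  have hnorm : HasDerivAt (fun t : ℝ => ‖p + t • v‖) 0 0 := by
    have := hline.norm_sq.sqrt (by simp [hp])
    simpa [hv, hp] using this
  have hcurve : HasDerivAt (fun t : ℝ => ‖p + t • v‖⁻¹ • (p + t • v)) v 0 := by
    have := (hnorm.inv (by simp [hp])).smul hline
    convert! this using 1
    simp [hp]
  have h2 : HasDerivAt (fun t : ℝ => G (‖p + t • v‖⁻¹ • (p + t • v))) (fderiv ℝ G p v) 0 :=
    HasFDerivAt.comp_hasDerivAt (0 : ℝ) (by simpa [hp] using hG.hasFDerivAt) hcurve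
  have hne : ∀ᶠ t : ℝ in nhds 0, p + t • v ≠ 0 :=
    hline.continuousAt.eventually_ne (by simpa using hp0)
  refine h1.unique (h2.congr_of_eventuallyEq (hne.mono fun t ht => ?_))
  simp only
  rw [hK_hom _ ht, hKG]
  rw [norm_smul, norm_inv, norm_norm, inv_mul_cancel₀ (norm_ne_zero_iff.2 ht)]

theorem contDiffAt_fderiv_apply {f : EuclideanSpace ℝ (Fin 3) → ℝ}
    (hf : ∀ x, x ≠ 0 → ContDiffAt ℝ (⊤ : ℕ∞) f x) (v x : EuclideanSpace ℝ (Fin 3)) (hx : x ≠ 0) :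
    ContDiffAt ℝ (⊤ : ℕ∞) (fun y => fderiv ℝ f y v) x :=
  ((hf x hx).fderiv_right (m := (⊤ : ℕ∞)) le_rfl).clm_apply contDiffAt_const

theorem fderiv_fderiv_apply_comm {f : EuclideanSpace ℝ (Fin 3) → ℝ}
    {x : EuclideanSpace ℝ (Fin 3)} (hf : ContDiffAt ℝ (⊤ : ℕ∞) f x)
    (v w : EuclideanSpace ℝ (Fin 3)) :
    fderiv ℝ (fun y => fderiv ℝ f y v) x w = fderiv ℝ (fun y => fderiv ℝ f y w) x v := by
  have two_le : (2 : WithTop ℕ∞) ≤ ((⊤ : ℕ∞) : WithTop ℕ∞) := WithTop.coe_le_coe.2 le_top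
  have hd : DifferentiableAt ℝ (fderiv ℝ f) x :=
    (hf.fderiv_right (m := 1) two_le).differentiableAt one_ne_zero
  have hsymm := (hf.isSymmSndFDerivAt (by simpa using two_le)).eq w v
  have h := fun u => (hd.hasFDerivAt.clm_apply (hasFDerivAt_const u x)).fderiv
  rw [h, h]
  simpa using hsymm

/-- Kazdan–Warner identity: Let `g = e^{2f} g_{S²}` be a metric on the unit
sphere `S² ⊂ ℝ³` conformal to the round metric, with Gauss curvature `K_g`, and let `x_i` be
the restriction of the `i`-th coordinate function.  Then
`∫_{S²} ⟨∇K_g, ∇x_i⟩_{g_{S²}} dvol_g = 0`, gradients taken in the round metric.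
Functions on `S²` are represented by `0`-homogeneous functions on `ℝ³ ∖ {0}`, so that on the
sphere the round (tangential) gradient of `K` is the ambient `gradient K`, the gradient of
`x_i` is `e_i − p_i p`, the Laplace–Beltrami operator on `S²` agrees with the ambient Euclidean
Laplacian `Δ`, the Gauss curvature of `g = e^{2f}g_{S²}` is `K_g = e^{−2f}(1 − Δf)`,
`dvol_g = e^{2f} dvol_{S²}`, and `dvol_{S²}` is the 2-dimensional Hausdorff measure `μH[2]`
on the unit sphere. -/
theorem kazdan_warner_identity
    (f K : EuclideanSpace ℝ (Fin 3) → ℝ)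
    (hf_smooth : ∀ x : EuclideanSpace ℝ (Fin 3), x ≠ 0 → ContDiffAt ℝ (⊤ : ℕ∞) f x)
    (hK_smooth : ∀ x : EuclideanSpace ℝ (Fin 3), x ≠ 0 → ContDiffAt ℝ (⊤ : ℕ∞) K x)
    (hf_hom : ∀ x : EuclideanSpace ℝ (Fin 3), x ≠ 0 → f x = f (‖x‖⁻¹ • x))
    (hK_hom : ∀ x : EuclideanSpace ℝ (Fin 3), x ≠ 0 → K x = K (‖x‖⁻¹ • x))
    -- K is the Gauss curvature of g = e^{2f} g_{S²}:  K = e^{−2f} (1 − Δ_{S²} f)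
    (hGaussCurv : ∀ p : EuclideanSpace ℝ (Fin 3), ‖p‖ = 1 →
      K p = Real.exp (-2 * f p) *
        (1 - ∑ i : Fin 3, fderiv ℝ (fun y => fderiv ℝ f y (EuclideanSpace.single i 1)) p
              (EuclideanSpace.single i 1))) :
    ∀ i : Fin 3,
      (∫ p in Metric.sphere (0 : EuclideanSpace ℝ (Fin 3)) 1,
        ⟪gradient K p, (EuclideanSpace.single i 1 - p i • p : EuclideanSpace ℝ (Fin 3))⟫
          * Real.exp (2 * f p) ∂(μH[2])) = 0 := by
  intro i
  set F : Fin 3 → EuclideanSpace ℝ (Fin 3) → ℝ :=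
    fun k y => fderiv ℝ f y (EuclideanSpace.single k 1) with hF
  set L : EuclideanSpace ℝ (Fin 3) → ℝ :=
    fun y => ∑ k, fderiv ℝ (F k) y (EuclideanSpace.single k 1) with hL
  have hF_smooth : ∀ k x, x ≠ 0 → ContDiffAt ℝ (⊤ : ℕ∞) (F k) x := fun k x hx =>
    contDiffAt_fderiv_apply hf_smooth _ x hx
  have hL_smooth : ∀ x, x ≠ 0 → ContDiffAt ℝ (⊤ : ℕ∞) L x := fun x hx =>
    ContDiffAt.sum fun k _ => contDiffAt_fderiv_apply (hF_smooth k) _ x hx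
  have hx_smooth : ∀ (k : Fin 3) x, ContDiffAt ℝ (⊤ : ℕ∞)
      (fun y : EuclideanSpace ℝ (Fin 3) => y k) x := fun k x =>
    (EuclideanSpace.proj k : EuclideanSpace ℝ (Fin 3) →L[ℝ] ℝ).contDiff.contDiffAt
  have hEuler : ∀ x, x ≠ 0 → ∑ j, x j * F j x = 0 := fun x hx => by
    rw [← fderiv_apply_eq_sum_coord]
    exact fderiv_apply_self_of_homogeneous hf_hom hx
      ((hf_smooth x hx).differentiableAt (by simp))
  let δ : Fin 3 → ℝ := fun j => if j = i then 1 else 0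
  let W : Fin 3 → EuclideanSpace ℝ (Fin 3) → ℝ := fun j y =>
    -((L y + (F 0 y * F 0 y + F 1 y * F 1 y + F 2 y * F 2 y)) *
      (δ j * (y 0 * y 0 + y 1 * y 1 + y 2 * y 2) - y i * y j)) -
      2 * (y i * F j y) + 2 * (F i y * F j y)
  have hW : ∀ j x, x ≠ 0 → ContDiffAt ℝ 1 (W j) x := fun j x hx => by
    refine ContDiffAt.of_le (n := (⊤ : ℕ∞)) ?_ (by exact_mod_cast le_top)
    have h0 := hF_smooth 0 x hx
    have h1 := hF_smooth 1 x hx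
    have h2 := hF_smooth 2 x hx
    have hi := hF_smooth i x hx
    have hj := hF_smooth j x hx
    have hLx := hL_smooth x hx
    fun_prop
  have htan : ∀ x, x ≠ 0 → ∑ j, x j * W j x = 0 := fun x hx => by
    have := hEuler x hx
    rw [Fin.sum_univ_three] at this ⊢
    fin_cases i
    · simp [W, δ]
      linear_combination (-2 * x 0 + 2 * F 0 x) * this
    · simp [W, δ]
      linear_combination (-2 * x 1 + 2 * F 1 x) * this
    · simp [W, δ]
      linear_combination (-2 * x 2 + 2 * F 2 x) * this
  rw [← integral_sphere_divergence_eq_zero hW htan]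
  refine setIntegral_congr_fun Metric.isClosed_sphere.measurableSet fun p hp => ?_
  have hp1 := mem_sphere_zero_iff_norm.1 hp
  have hp0 : p ≠ 0 := fun h0 => by simp [h0] at hp1
  have hr : p 0 ^ 2 + p 1 ^ 2 + p 2 ^ 2 = 1 := by
    have := EuclideanSpace.real_norm_sq_eq p
    rw [hp1, Fin.sum_univ_three] at this
    linarith
  have hfd : HasFDerivAt f _ p :=
    ((hf_smooth p hp0).differentiableAt (by simp)).hasFDerivAt
  have hFd : ∀ k, HasFDerivAt (F k) _ p := fun k =>
    ((hF_smooth k p hp0).differentiableAt (by simp)).hasFDerivAt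
  have hLd : HasFDerivAt L _ p := ((hL_smooth p hp0).differentiableAt (by simp)).hasFDerivAt
  have hG : HasFDerivAt (fun y => Real.exp (-2 * f y) * (1 - L y)) _ p :=
    (hfd.const_mul (-2)).exp.mul (hLd.const_sub 1)
  have hX : ⟪p, (EuclideanSpace.single i 1 - p i • p : EuclideanSpace ℝ (Fin 3))⟫ = 0 := by
    simp [inner_sub_right, inner_smul_right, EuclideanSpace.inner_single_right, hp1]
  have hKX := fderiv_tangent_eq_of_eqOn_sphere hK_hom hGaussCurv hp1 hX
    ((hK_smooth p hp0).differentiableAt (by simp)) hG.differentiableAt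
  rw [hG.fderiv] at hKX
  have hgrad : ⟪gradient K p, (EuclideanSpace.single i 1 - p i • p : EuclideanSpace ℝ (Fin 3))⟫ =
      fderiv ℝ K p (EuclideanSpace.single i 1 - p i • p) := by
    rw [← toDual_gradient, InnerProductSpace.toDual_apply_apply]
  have hfp : fderiv ℝ f p p = 0 :=
    fderiv_apply_self_of_homogeneous hf_hom hp0 hfd.differentiableAt
  have hLp := fderiv_apply_eq_sum_coord L p p
  rw [Fin.sum_univ_three] at hLp
  have hexp : Real.exp (-(2 * f p)) * Real.exp (2 * f p) = 1 := by
    rw [← Real.exp_add]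
    simp
  have hlhs : ⟪gradient K p, (EuclideanSpace.single i 1 - p i • p : EuclideanSpace ℝ (Fin 3))⟫ *
      Real.exp (2 * f p) = -fderiv ℝ L p (EuclideanSpace.single i 1) + p i * fderiv ℝ L p p -
        2 * F i p * (1 - L p) := by
    rw [hgrad, hKX]
    have hFi : fderiv ℝ f p (EuclideanSpace.single i 1) = F i p := rfl
    simp [hfp, hFi]
    linear_combination (-fderiv ℝ L p (EuclideanSpace.single i 1) + p i * fderiv ℝ L p p -
      2 * F i p * (1 - L p)) * hexp
  have hWd : ∀ j, HasFDerivAt (W j) _ p := fun j =>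
    ((((hLd.add ((((hFd 0).mul (hFd 0)).add ((hFd 1).mul (hFd 1))).add
      ((hFd 2).mul (hFd 2)))).mul
      ((((((hasFDerivAt_coord 0 p).mul (hasFDerivAt_coord 0 p)).add
        ((hasFDerivAt_coord 1 p).mul (hasFDerivAt_coord 1 p))).add
        ((hasFDerivAt_coord 2 p).mul (hasFDerivAt_coord 2 p))).const_mul (δ j)).sub
        ((hasFDerivAt_coord i p).mul (hasFDerivAt_coord j p)))).neg.sub
      (((hasFDerivAt_coord i p).mul (hFd j)).const_mul 2)).add
      (((hFd i).mul (hFd j)).const_mul 2))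
  have hE := sum_coord_mul_fderiv_of_sum_eq_zero
    (fun j x hx => (hF_smooth j x hx).differentiableAt (by simp)) hEuler hp0
  have hE0 := hE 0
  have hE1 := hE 1
  have hE2 := hE 2
  have hs : ∀ j k, fderiv ℝ (F j) p (EuclideanSpace.single k 1) =
      fderiv ℝ (F k) p (EuclideanSpace.single j 1) := fun j k =>
    fderiv_fderiv_apply_comm (hf_smooth p hp0) _ _
  have hs01 := hs 0 1
  have hs02 := hs 0 2
  have hs12 := hs 1 2
  have hLv : L p = _ := Fin.sum_univ_three _
  simp only [Fin.sum_univ_three, hs01, hs02, hs12] at hE0 hE1 hE2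
  simp only
  rw [hlhs, hLp, Fin.sum_univ_three, (hWd 0).fderiv, (hWd 1).fderiv, (hWd 2).fderiv]
  fin_cases i
  · simp [δ, hs01, hs02, hs12]
    linear_combination
      (fderiv ℝ L p (EuclideanSpace.single 0 1) + 2 *
        (F 0 p * fderiv ℝ (F 0) p (EuclideanSpace.single 0 1) +
          F 1 p * fderiv ℝ (F 1) p (EuclideanSpace.single 0 1) +
          F 2 p * fderiv ℝ (F 2) p (EuclideanSpace.single 0 1))) * hr -
      2 * p 0 * (F 0 p * hE0 + F 1 p * hE1 + F 2 p * hE2) -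
      (2 * p 0 - 2 * F 0 p) * hLv
  · simp [δ, hs01, hs02, hs12]
    linear_combination
      (fderiv ℝ L p (EuclideanSpace.single 1 1) + 2 *
        (F 0 p * fderiv ℝ (F 1) p (EuclideanSpace.single 0 1) +
          F 1 p * fderiv ℝ (F 1) p (EuclideanSpace.single 1 1) +
          F 2 p * fderiv ℝ (F 2) p (EuclideanSpace.single 1 1))) * hr -
      2 * p 1 * (F 0 p * hE0 + F 1 p * hE1 + F 2 p * hE2) -
      (2 * p 1 - 2 * F 1 p) * hLv
  · simp [δ, hs01, hs02, hs12]
    linear_combination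
      (fderiv ℝ L p (EuclideanSpace.single 2 1) + 2 *
        (F 0 p * fderiv ℝ (F 2) p (EuclideanSpace.single 0 1) +
          F 1 p * fderiv ℝ (F 2) p (EuclideanSpace.single 1 1) +
          F 2 p * fderiv ℝ (F 2) p (EuclideanSpace.single 2 1))) * hr -
      2 * p 2 * (F 0 p * hE0 + F 1 p * hE1 + F 2 p * hE2) -
      (2 * p 2 - 2 * F 2 p) * hLv
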